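/- (Soundness of the flow-domain attack.) Let F be any function on ℝ^{nm}, R and μ probability distributions on the n×m pixel grid, δ^μ a flow with Δ(R, δ^μ) = μ, and ε > 0. Suppose δ̂ is a flow such that Δ(R, δ̂) is a probability distribution, ‖δ̂ − δ^μ‖₁ ≤ ε, and F(Δ(R, δ̂)) ≠ F(μ). Then μ̄ := Δ(R, δ̂) is a Wasserstein adversarial example: μ̄ is a probability distribution with F(μ̄) ≠ F(μ) and W₁(μ̄, μ) ≤ ‖δ̂ − δ^μ‖₁ ≤ ε. -/

import Mathlib

namespace WassersteinFlow

/-- A flow on the `n × m` grid: a pair `(δ→, δ↓)` with `δ→ ∈ ℝ^{n×(m-1)}`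
and `δ↓ ∈ ℝ^{(n-1)×m}`. -/
abbrev Flow (n m : ℕ) := (Fin n → Fin (m - 1) → ℝ) × (Fin (n - 1) → Fin m → ℝ)

/-- Entry access with out-of-range indices giving `0` (0-based indices). -/
def entry {a b : ℕ} (δ : Fin a → Fin b → ℝ) (i j : ℤ) : ℝ :=
  if h : 0 ≤ i ∧ i < (a : ℤ) ∧ 0 ≤ j ∧ j < (b : ℤ) then
    δ ⟨i.toNat, by omega⟩ ⟨j.toNat, by omega⟩
  else 0

/-- The flow application map `Δ`:
`Δ(μ,δ)_{i,j} = μ_{i,j} + δ↓_{i−1,j} + δ→_{i,j−1} − δ↓_{i,j} − δ→_{i,j}`,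
with out-of-range entries taken to be `0`. -/
def applyFlow {n m : ℕ} (μ : Fin n × Fin m → ℝ) (δ : Flow n m) : Fin n × Fin m → ℝ :=
  fun x =>
    μ x + entry δ.2 ((x.1 : ℤ) - 1) (x.2 : ℤ) + entry δ.1 (x.1 : ℤ) ((x.2 : ℤ) - 1)
      - entry δ.2 (x.1 : ℤ) (x.2 : ℤ) - entry δ.1 (x.1 : ℤ) (x.2 : ℤ)

/-- The `L¹`-norm of a flow: the sum of absolute values of all entries. -/
def flowL1 {n m : ℕ} (δ : Flow n m) : ℝ :=
  (∑ i, ∑ j, |δ.1 i j|) + (∑ i, ∑ j, |δ.2 i j|)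

/-- A probability distribution on the grid. -/
def IsProbDist {n m : ℕ} (μ : Fin n × Fin m → ℝ) : Prop :=
  (∀ x, 0 ≤ μ x) ∧ ∑ x, μ x = 1

/-- The `L¹` ground metric `d((i,j),(k,l)) = |i−k| + |j−l|` on the grid. -/
def gd {n m : ℕ} (x y : Fin n × Fin m) : ℝ :=
  ((|(x.1 : ℤ) - (y.1 : ℤ)| + |(x.2 : ℤ) - (y.2 : ℤ)| : ℤ) : ℝ)

/-- `π` is a coupling of `μ` and `ν`. -/
def IsCoupling {n m : ℕ} (μ ν : Fin n × Fin m → ℝ)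
    (π : (Fin n × Fin m) × (Fin n × Fin m) → ℝ) : Prop :=
  (∀ p, 0 ≤ π p) ∧ (∀ x, ∑ y, π (x, y) = μ x) ∧ (∀ y, ∑ x, π (x, y) = ν y)

/-- The 1-Wasserstein distance with `L¹` ground metric. -/
noncomputable def W1 {n m : ℕ} (μ ν : Fin n × Fin m → ℝ) : ℝ :=
  sInf {c | ∃ π, IsCoupling μ ν π ∧
    c = ∑ p : (Fin n × Fin m) × (Fin n × Fin m), gd p.1 p.2 * π p}

/-- Index type for flattened flows. -/
abbrev FlowIdx (n m : ℕ) := (Fin n × Fin (m - 1)) ⊕ (Fin (n - 1) × Fin m)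

/-- Flatten a flow to a vector in `ℝ^{n(m−1)+(n−1)m}`. -/
def flat {n m : ℕ} (δ : Flow n m) : FlowIdx n m → ℝ :=
  Sum.elim (fun p => δ.1 p.1 p.2) (fun p => δ.2 p.1 p.2)

section Rerouting

variable {V : Type*} [Fintype V] [DecidableEq V]

/-- Given a transport plan `f`, redirect the mass `k * f x v * f v y` travelling along `x → v → y`
directly along `x → y`, for all `x` and `y`. -/
def reroute (f : V → V → ℝ) (v : V) (k : ℝ) (x y : V) : ℝ :=
  f x y - (if y = v then k * (∑ z, f v z) * f x v else 0)
    - (if x = v then k * (∑ z, f z v) * f v y else 0) + k * (f x v * f v y)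

lemma reroute_nonneg {f : V → V → ℝ} (hf : ∀ x y, 0 ≤ f x y) {v : V} (hv : f v v = 0) {k : ℝ}
    (hk : 0 ≤ k) (hout : k * ∑ z, f v z ≤ 1) (hin : k * ∑ z, f z v ≤ 1) (x y : V) :
    0 ≤ reroute f v k x y := by
  unfold reroute
  by_cases hx : x = v <;> by_cases hy : y = v
  · subst hx hy; simp [hv]
  · subst hx
    simp only [hy, hv, if_true, if_false]
    nlinarith [hf x y]
  · subst hy
    simp only [hx, hv, if_true, if_false]
    nlinarith [hf x y]
  · simp only [hx, hy, if_false, sub_zero]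
    have := hf x y
    have := mul_nonneg hk (mul_nonneg (hf x v) (hf v y))
    linarith

lemma sum_reroute_right (f : V → V → ℝ) (v : V) (k : ℝ) (x : V) :
    ∑ y, reroute f v k x y
      = ∑ y, f x y - if x = v then k * (∑ z, f z v) * ∑ z, f v z else 0 := by
  simp only [reroute, Finset.sum_add_distrib, Finset.sum_sub_distrib, Finset.sum_ite_eq',
    Finset.mem_univ, if_true, ← Finset.mul_sum]
  split_ifs with hx
  · rw [← Finset.mul_sum]; ring
  · simp only [Finset.sum_const_zero]; ring

lemma sum_reroute_left (f : V → V → ℝ) (v : V) (k : ℝ) (y : V) :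
    ∑ x, reroute f v k x y
      = ∑ x, f x y - if y = v then k * (∑ z, f z v) * ∑ z, f v z else 0 := by
  simp only [reroute, Finset.sum_add_distrib, Finset.sum_sub_distrib, Finset.sum_ite_eq',
    Finset.mem_univ, if_true, ← Finset.mul_sum, ← Finset.sum_mul]
  split_ifs with hy
  · rw [← Finset.mul_sum]; ring
  · simp only [Finset.sum_const_zero]; ring

lemma cost_reroute_le {d : V → V → ℝ} (htri : ∀ x y z, d x z ≤ d x y + d y z)
    {f : V → V → ℝ} (hf : ∀ x y, 0 ≤ f x y) (v : V) {k : ℝ} (hk : 0 ≤ k) :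
    ∑ x, ∑ y, d x y * reroute f v k x y ≤ ∑ x, ∑ y, d x y * f x y := by
  have hdetour : ∑ x, ∑ y, d x y * (k * (f x v * f v y))
      ≤ ∑ x, ∑ y, (d x v + d v y) * (k * (f x v * f v y)) :=
    Finset.sum_le_sum fun x _ => Finset.sum_le_sum fun y _ =>
      mul_le_mul_of_nonneg_right (htri x v y) (mul_nonneg hk (mul_nonneg (hf x v) (hf v y)))
  have hsplit : ∑ x, ∑ y, (d x v + d v y) * (k * (f x v * f v y))
      = k * (∑ z, f v z) * (∑ x, d x v * f x v) + k * (∑ z, f z v) * ∑ y, d v y * f v y := by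
    have h₁ : ∑ x, ∑ y, (d x v * f x v) * f v y = (∑ x, d x v * f x v) * ∑ z, f v z :=
      (Finset.sum_mul_sum _ _ _ _).symm
    have h₂ : ∑ x, ∑ y, f x v * (d v y * f v y) = (∑ z, f z v) * ∑ y, d v y * f v y :=
      (Finset.sum_mul_sum _ _ _ _).symm
    rw [mul_assoc, mul_comm (∑ z, f v z), ← h₁, mul_assoc, ← h₂]
    simp only [Finset.mul_sum, ← Finset.sum_add_distrib]
    exact Finset.sum_congr rfl fun x _ => Finset.sum_congr rfl fun y _ => by ring
  have hexpand : ∑ x, ∑ y, d x y * reroute f v k x y = ∑ x, ∑ y, d x y * f x y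
      - k * (∑ z, f v z) * (∑ x, d x v * f x v) - k * (∑ z, f z v) * (∑ y, d v y * f v y)
      + ∑ x, ∑ y, d x y * (k * (f x v * f v y)) := by
    have h₁ : ∑ x, ∑ y, d x y * (if y = v then k * (∑ z, f v z) * f x v else 0)
        = k * (∑ z, f v z) * ∑ x, d x v * f x v := by
      simp only [mul_ite, mul_zero, Finset.sum_ite_eq', Finset.mem_univ, if_true]
      rw [Finset.mul_sum _ fun x => d x v * f x v]
      exact Finset.sum_congr rfl fun x _ => by ring
    have h₂ : ∑ x, ∑ y, d x y * (if x = v then k * (∑ z, f z v) * f v y else 0)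
        = k * (∑ z, f z v) * ∑ y, d v y * f v y := by
      rw [Finset.sum_comm]
      simp only [mul_ite, mul_zero, Finset.sum_ite_eq', Finset.mem_univ, if_true]
      rw [Finset.mul_sum _ fun y => d v y * f v y]
      exact Finset.sum_congr rfl fun y _ => by ring
    rw [← h₁, ← h₂]
    simp only [reroute, mul_add, mul_sub, Finset.sum_add_distrib, Finset.sum_sub_distrib]
  linarith

/-- At a single vertex `v`, a transport plan can be modified so that no more mass leaves `v` than
`v` holds initially. -/
lemma exists_plan_outflow_le {d : V → V → ℝ} (hd : ∀ x y, 0 ≤ d x y)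
    (htri : ∀ x y z, d x z ≤ d x y + d y z) {μ ν : V → ℝ} (hμ : ∀ x, 0 ≤ μ x)
    (hν : ∀ x, 0 ≤ ν x) {f : V → V → ℝ} (hf : ∀ x y, 0 ≤ f x y)
    (hbal : ∀ x, ∑ y, f x y - ∑ y, f y x = μ x - ν x) (v : V) :
    ∃ g : V → V → ℝ, (∀ x y, 0 ≤ g x y) ∧ (∀ x, ∑ y, g x y - ∑ y, g y x = μ x - ν x) ∧
      ∑ x, ∑ y, d x y * g x y ≤ ∑ x, ∑ y, d x y * f x y ∧
      ∑ y, g v y ≤ μ v ∧ ∀ x, ∑ y, g x y ≤ ∑ y, f x y := by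
  obtain ⟨h, hh, hhv, hhf, hhbal⟩ : ∃ h : V → V → ℝ, (∀ x y, 0 ≤ h x y) ∧ h v v = 0 ∧
      (∀ x y, h x y ≤ f x y) ∧ ∀ x, ∑ y, h x y - ∑ y, h y x = μ x - ν x := by
    refine ⟨fun x y => f x y - if x = v ∧ y = v then f v v else 0, fun x y => ?_, by simp,
      fun x y => ?_, fun x => ?_⟩
    · dsimp only
      split_ifs with hxy
      · rw [hxy.1, hxy.2, sub_self]
      · simpa using hf x y
    · dsimp only
      split_ifs
      · linarith [hf v v]
      · simp
    · simp only [Finset.sum_sub_distrib, and_comm (a := x = v)]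
      linarith [hbal x]
  have hcost : ∑ x, ∑ y, d x y * h x y ≤ ∑ x, ∑ y, d x y * f x y :=
    Finset.sum_le_sum fun x _ => Finset.sum_le_sum fun y _ =>
      mul_le_mul_of_nonneg_left (hhf x y) (hd x y)
  have hout : ∀ x, ∑ y, h x y ≤ ∑ y, f x y := fun x => Finset.sum_le_sum fun y _ => hhf x y
  rcases le_or_gt (∑ y, h v y) (μ v) with hle | hgt
  · exact ⟨h, hh, hhbal, hcost, hle, hout⟩
  set a := ∑ z, h z v with ha
  set b := ∑ z, h v z with hb
  have hbalv : b - a = μ v - ν v := hhbal v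
  have hb0 : 0 < b := (hμ v).trans_lt hgt
  have ha0 : 0 < a := by linarith [hν v]
  have hk : 0 ≤ (b - μ v) / (a * b) := div_nonneg (by linarith) (by positivity)
  have hkab : (b - μ v) / (a * b) * a * b = b - μ v := by field_simp
  have hkb : (b - μ v) / (a * b) * b ≤ 1 := by
    rw [div_mul_eq_mul_div, div_le_one (by positivity)]
    nlinarith [hν v]
  have hka : (b - μ v) / (a * b) * a ≤ 1 := by
    rw [div_mul_eq_mul_div, div_le_one (by positivity)]
    nlinarith [hμ v]
  refine ⟨reroute h v ((b - μ v) / (a * b)), reroute_nonneg hh hhv hk hkb hka, fun x => ?_,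
    (cost_reroute_le htri hh v hk).trans hcost, ?_, fun x => ?_⟩
  · rw [sum_reroute_right, sum_reroute_left]
    linarith [hhbal x]
  · rw [sum_reroute_right, if_pos rfl, ← ha, ← hb, hkab]
    linarith
  · rw [sum_reroute_right, ← ha, ← hb, hkab]
    refine le_trans ?_ (hout x)
    split_ifs <;> linarith

/-- A transport plan turning `μ` into `ν`, possibly through intermediate vertices, gives rise to a
coupling that costs no more. -/
theorem exists_coupling_of_plan {d : V → V → ℝ} (hd : ∀ x y, 0 ≤ d x y) (hd₀ : ∀ x, d x x = 0)
    (htri : ∀ x y z, d x z ≤ d x y + d y z) {μ ν : V → ℝ} (hμ : ∀ x, 0 ≤ μ x)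
    (hν : ∀ x, 0 ≤ ν x) {f : V → V → ℝ} (hf : ∀ x y, 0 ≤ f x y)
    (hbal : ∀ x, ∑ y, f x y - ∑ y, f y x = μ x - ν x) :
    ∃ π : V → V → ℝ, (∀ x y, 0 ≤ π x y) ∧ (∀ x, ∑ y, π x y = μ x) ∧ (∀ y, ∑ x, π x y = ν y) ∧
      ∑ x, ∑ y, d x y * π x y ≤ ∑ x, ∑ y, d x y * f x y := by
  have key : ∀ s : Finset V, ∃ g : V → V → ℝ, (∀ x y, 0 ≤ g x y) ∧
      (∀ x, ∑ y, g x y - ∑ y, g y x = μ x - ν x) ∧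
      ∑ x, ∑ y, d x y * g x y ≤ ∑ x, ∑ y, d x y * f x y ∧ ∀ x ∈ s, ∑ y, g x y ≤ μ x := by
    intro s
    induction s using Finset.induction_on with
    | empty => exact ⟨f, hf, hbal, le_rfl, by simp⟩
    | insert v s _ ih =>
      obtain ⟨g, hg, hgbal, hgcost, hgs⟩ := ih
      obtain ⟨g', hg', hgbal', hgcost', hgv, hgle⟩ :=
        exists_plan_outflow_le hd htri hμ hν hg hgbal v
      refine ⟨g', hg', hgbal', hgcost'.trans hgcost, fun x hx => ?_⟩
      rcases Finset.mem_insert.1 hx with rfl | hx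
      · exact hgv
      · exact (hgle x).trans (hgs x hx)
  obtain ⟨g, hg, hgbal, hgcost, hgle⟩ := key Finset.univ
  refine ⟨fun x y => g x y + if x = y then μ x - ∑ z, g x z else 0, fun x y => ?_, fun x => ?_,
    fun y => ?_, ?_⟩
  · refine add_nonneg (hg x y) ?_
    split_ifs
    · linarith [hgle x (Finset.mem_univ x)]
    · exact le_rfl
  · simp [Finset.sum_add_distrib]
  · simp only [Finset.sum_add_distrib, Finset.sum_ite_eq', Finset.mem_univ, if_true]
    linarith [hgbal y]
  · simpa [mul_add, Finset.sum_add_distrib, hd₀] using hgcost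

/-- A signed flow `w` on the edges `s e → t e` that turns `ν` into `μ` gives rise to a coupling of
`μ` and `ν` that costs no more. -/
theorem exists_coupling_of_edge_flow {E : Type*} [Fintype E] (s t : E → V) (w : E → ℝ)
    {d : V → V → ℝ} (hd : ∀ x y, 0 ≤ d x y) (hd₀ : ∀ x, d x x = 0)
    (hsymm : ∀ x y, d x y = d y x) (htri : ∀ x y z, d x z ≤ d x y + d y z)
    {μ ν : V → ℝ} (hμ : ∀ x, 0 ≤ μ x) (hν : ∀ x, 0 ≤ ν x)
    (hw : ∀ x, μ x = ν x + ∑ e, (if t e = x then w e else 0) - ∑ e, if s e = x then w e else 0) :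
    ∃ π : V → V → ℝ, (∀ x y, 0 ≤ π x y) ∧ (∀ x, ∑ y, π x y = μ x) ∧ (∀ y, ∑ x, π x y = ν y) ∧
      ∑ x, ∑ y, d x y * π x y ≤ ∑ e, d (s e) (t e) * |w e| := by
  let f : V → V → ℝ := fun x y => ∑ e, ((if t e = x then if s e = y then (w e)⁺ else 0 else 0) +
    (if s e = x then if t e = y then (w e)⁻ else 0 else 0))
  have hf : ∀ x y, 0 ≤ f x y := fun x y => Finset.sum_nonneg fun e _ => by
    have := posPart_nonneg (w e)
    have := negPart_nonneg (w e)
    split_ifs <;> linarith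
  have hbal : ∀ x, ∑ y, f x y - ∑ y, f y x = μ x - ν x := by
    intro x
    rw [hw x, add_sub_assoc, add_sub_cancel_left]
    simp only [f, ← Finset.sum_sub_distrib]
    rw [Finset.sum_comm]
    refine Finset.sum_congr rfl fun e _ => ?_
    simp only [Finset.sum_sub_distrib, Finset.sum_add_distrib]
    by_cases h₁ : t e = x <;> by_cases h₂ : s e = x <;> simp [h₁, h₂]
  have hcost : ∑ x, ∑ y, d x y * f x y = ∑ e, d (s e) (t e) * |w e| := by
    simp only [f, Finset.mul_sum]
    rw [Finset.sum_congr rfl fun x _ => Finset.sum_comm, Finset.sum_comm]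
    refine Finset.sum_congr rfl fun e _ => ?_
    rw [← posPart_add_negPart (w e), mul_add]
    simp only [mul_add, Finset.sum_add_distrib]
    congr 1
    · rw [hsymm]
      simp only [mul_ite, mul_zero]
      rw [Finset.sum_comm]
      simp
    · simp only [mul_ite, mul_zero]
      rw [Finset.sum_comm]
      simp
  rw [← hcost]
  exact exists_coupling_of_plan hd hd₀ htri hμ hν hf hbal

end Rerouting

lemma gd_nonneg {n m : ℕ} (x y : Fin n × Fin m) : 0 ≤ gd x y := by
  unfold gd
  positivity

lemma gd_self {n m : ℕ} (x : Fin n × Fin m) : gd x x = 0 := by simp [gd]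

lemma gd_comm {n m : ℕ} (x y : Fin n × Fin m) : gd x y = gd y x := by
  simp only [gd, abs_sub_comm]

lemma gd_triangle {n m : ℕ} (x y z : Fin n × Fin m) : gd x z ≤ gd x y + gd y z := by
  unfold gd
  rw [← Int.cast_add, Int.cast_le]
  have := abs_sub_le (x.1 : ℤ) y.1 z.1
  have := abs_sub_le (x.2 : ℤ) y.2 z.2
  linarith

lemma entry_eq_sum {a b : ℕ} (δ : Fin a → Fin b → ℝ) (i j : ℤ) :
    entry δ i j = ∑ p : Fin a × Fin b, if (p.1 : ℤ) = i ∧ (p.2 : ℤ) = j then δ p.1 p.2 else 0 := by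
  unfold entry
  split_ifs with h
  · rw [Finset.sum_eq_single (⟨i.toNat, by omega⟩, ⟨j.toNat, by omega⟩)]
    · rw [if_pos ⟨Int.toNat_of_nonneg h.1, Int.toNat_of_nonneg h.2.2.1⟩]
    · intro p _ hp
      refine if_neg fun hij => hp ?_
      ext <;> simp <;> omega
    · simp
  · refine (Finset.sum_eq_zero fun p _ => if_neg fun hij => h ?_).symm
    have := p.1.isLt
    have := p.2.isLt
    omega

lemma entry_sub {a b : ℕ} (δ δ' : Fin a → Fin b → ℝ) (i j : ℤ) :
    entry (δ - δ') i j = entry δ i j - entry δ' i j := by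
  unfold entry
  split_ifs <;> simp

/-- The pixel from which a grid edge departs. -/
def edgeSrc {n m : ℕ} : FlowIdx n m → Fin n × Fin m :=
  Sum.elim (fun p => (p.1, ⟨p.2, by omega⟩)) (fun p => (⟨p.1, by omega⟩, p.2))

/-- The pixel at which a grid edge arrives. -/
def edgeTgt {n m : ℕ} : FlowIdx n m → Fin n × Fin m :=
  Sum.elim (fun p => (p.1, ⟨p.2 + 1, by omega⟩)) (fun p => (⟨p.1 + 1, by omega⟩, p.2))

lemma gd_edge {n m : ℕ} (e : FlowIdx n m) : gd (edgeSrc e) (edgeTgt e) = 1 := by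
  rcases e with p | p <;> simp [gd, edgeSrc, edgeTgt]

lemma flowL1_eq_sum {n m : ℕ} (δ : Flow n m) : flowL1 δ = ∑ e, |flat δ e| := by
  simp [flowL1, flat, Fintype.sum_prod_type]

lemma applyFlow_eq_sum {n m : ℕ} (μ : Fin n × Fin m → ℝ) (δ : Flow n m) (x : Fin n × Fin m) :
    applyFlow μ δ x = μ x + ∑ e, (if edgeTgt e = x then flat δ e else 0)
      - ∑ e, if edgeSrc e = x then flat δ e else 0 := by
  have h₁ : entry δ.1 (x.1 : ℤ) ((x.2 : ℤ) - 1)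
      = ∑ p, if edgeTgt (.inl p) = x then flat δ (.inl p) else 0 := by
    rw [entry_eq_sum]
    refine Finset.sum_congr rfl fun p _ => if_congr ?_ rfl rfl
    simp only [edgeTgt, Sum.elim_inl, Prod.ext_iff, Fin.ext_iff]
    omega
  have h₂ : entry δ.2 ((x.1 : ℤ) - 1) (x.2 : ℤ)
      = ∑ p, if edgeTgt (.inr p) = x then flat δ (.inr p) else 0 := by
    rw [entry_eq_sum]
    refine Finset.sum_congr rfl fun p _ => if_congr ?_ rfl rfl
    simp only [edgeTgt, Sum.elim_inr, Prod.ext_iff, Fin.ext_iff]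
    omega
  have h₃ : entry δ.1 (x.1 : ℤ) (x.2 : ℤ)
      = ∑ p, if edgeSrc (.inl p) = x then flat δ (.inl p) else 0 := by
    rw [entry_eq_sum]
    refine Finset.sum_congr rfl fun p _ => if_congr ?_ rfl rfl
    simp only [edgeSrc, Sum.elim_inl, Prod.ext_iff, Fin.ext_iff]
    omega
  have h₄ : entry δ.2 (x.1 : ℤ) (x.2 : ℤ)
      = ∑ p, if edgeSrc (.inr p) = x then flat δ (.inr p) else 0 := by
    rw [entry_eq_sum]
    refine Finset.sum_congr rfl fun p _ => if_congr ?_ rfl rfl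
    simp only [edgeSrc, Sum.elim_inr, Prod.ext_iff, Fin.ext_iff]
    omega
  rw [applyFlow, h₁, h₂, h₃, h₄, Fintype.sum_sum_type, Fintype.sum_sum_type]
  ring

lemma applyFlow_sub {n m : ℕ} (R : Fin n × Fin m → ℝ) (δ δ' : Flow n m) :
    applyFlow (applyFlow R δ') (δ - δ') = applyFlow R δ := by
  funext x
  simp only [applyFlow, Prod.fst_sub, Prod.snd_sub, entry_sub]
  ring

/-- The `L¹`-norm of a flow bounds the Wasserstein distance between the two distributions that it
connects. -/
theorem W1_applyFlow_le {n m : ℕ} (ν : Fin n × Fin m → ℝ) (δ : Flow n m) (hν : ∀ x, 0 ≤ ν x)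
    (hδ : ∀ x, 0 ≤ applyFlow ν δ x) : W1 (applyFlow ν δ) ν ≤ flowL1 δ := by
  obtain ⟨π, hπ, hrow, hcol, hcost⟩ := exists_coupling_of_edge_flow edgeSrc edgeTgt (flat δ)
    gd_nonneg gd_self gd_comm gd_triangle hδ hν (applyFlow_eq_sum ν δ)
  simp only [gd_edge, one_mul, ← flowL1_eq_sum] at hcost
  refine le_trans (csInf_le ⟨0, ?_⟩ ?_) hcost
  · rintro _ ⟨ρ, hρ, rfl⟩
    exact Finset.sum_nonneg fun p _ => mul_nonneg (gd_nonneg _ _) (hρ.1 p)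
  · refine ⟨fun p => π p.1 p.2, ⟨fun p => hπ _ _, hrow, hcol⟩, ?_⟩
    exact (Fintype.sum_prod_type (fun p => gd p.1 p.2 * π p.1 p.2)).symm

/-- Soundness of the flow-domain attack: if `Δ(R, δ̂)` is a probability distribution,
`‖δ̂ − δ^μ‖₁ ≤ ε` and `F(Δ(R, δ̂)) ≠ F(μ)`, then `μ̄ = Δ(R, δ̂)` is a Wasserstein
adversarial example: `F(μ̄) ≠ F(μ)` and `W₁(μ̄, μ) ≤ ‖δ̂ − δ^μ‖₁ ≤ ε`. -/
theorem attack_soundness {α : Type*} (n m : ℕ)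
    (F : (Fin n × Fin m → ℝ) → α)
    (R μ : Fin n × Fin m → ℝ) (hR : IsProbDist R) (hμ : IsProbDist μ)
    (δμ : Flow n m) (hδμ : applyFlow R δμ = μ)
    (ε : ℝ) (hε : 0 < ε)
    (δhat : Flow n m)
    (hfeas : IsProbDist (applyFlow R δhat))
    (hl1 : flowL1 (δhat - δμ) ≤ ε)
    (hadv : F (applyFlow R δhat) ≠ F μ) :
    IsProbDist (applyFlow R δhat) ∧ F (applyFlow R δhat) ≠ F μ ∧
      W1 (applyFlow R δhat) μ ≤ flowL1 (δhat - δμ) ∧ flowL1 (δhat - δμ) ≤ ε := by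
  subst hδμ
  refine ⟨hfeas, hadv, ?_, hl1⟩
  have h := W1_applyFlow_le (applyFlow R δμ) (δhat - δμ) hμ.1
  rw [applyFlow_sub] at h
  exact h hfeas.1

end WassersteinFlow
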